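/- Ring protocol optimisation: let a and c be distinct participants, 'add' and 'sub' labels, and S a sort. For each choice function f : ℕ → Bool, let ℓ_f(i) denote 'add' if f(i) is true and 'sub' otherwise, and let W_f be the infinite SISO tree satisfying W_f = c!ℓ_f(0)(S).a?add(S).W_{f∘succ} (i.e., the stream whose i-th block is c!ℓ_f(i).a?add). Then for every f : ℕ → Bool, W_f ≲ a?add(S).W_f; i.e., every single-output branch of the optimised ring type (which outputs to c before inputting from a) refines the corresponding branch of the projected type (which inputs from a first). -/

import Mathlib

/-- A single action of a SISO tree: an input from `p` or an output to `p`,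
with label `l` and payload sort `s`. -/
inductive Act (P L S : Type) : Type
  | inp (p : P) (l : L) (s : S)
  | out (p : P) (l : L) (s : S)

/-- A SISO tree is a possibly infinite sequence of actions; `Seq.nil` is `end`. -/
abbrev SISO (P L S : Type) : Type := Stream'.Seq (Act P L S)

/-- Prepend a finite list of actions to a SISO tree. -/
def prepend {P L S : Type} (A : List (Act P L S)) (W : SISO P L S) : SISO P L S :=
  A.foldr Stream'.Seq.cons W

/-- The (participant, direction) action of a term: `(p, true)` for `p?`, `(p, false)` for `p!`. -/
def actOf {P L S : Type} : Act P L S → P × Bool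
  | Act.inp p _ _ => (p, true)
  | Act.out p _ _ => (p, false)

/-- `act(W)`: the set of input/output actions occurring in the tree `W`. -/
def acts {P L S : Type} (W : SISO P L S) : Set (P × Bool) :=
  { a | ∃ (n : ℕ) (t : Act P L S), W.get? n = some t ∧ actOf t = a }

/-- An `𝒜^p`-context: a nonempty finite sequence of input actions from participants `q ≠ p`. -/
def ACtx {P L S : Type} (p : P) (A : List (Act P L S)) : Prop :=
  A ≠ [] ∧ ∀ t ∈ A, ∃ q l s, t = Act.inp q l s ∧ q ≠ p

/-- A `ℬ^p`-context: a nonempty finite sequence of actions in which every output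
is to a participant `q ≠ p`. -/
def BCtx {P L S : Type} (p : P) (B : List (Act P L S)) : Prop :=
  B ≠ [] ∧ ∀ t ∈ B, ∀ q l s, t = Act.out q l s → q ≠ p

/-- One step of the tree refinement rules `[end]`, `[in]`, `[out]`, `[𝒜]`, `[ℬ]`,
with coinductive premises taken from the relation `R`. -/
inductive Step {P L S : Type} (le : S → S → Prop)
    (R : SISO P L S → SISO P L S → Prop) : SISO P L S → SISO P L S → Prop
  | end_ : Step le R Stream'.Seq.nil Stream'.Seq.nil
  | inp {p : P} {l : L} {s s' : S} {W W' : SISO P L S} :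
      le s' s → R W W' →
      Step le R (Stream'.Seq.cons (Act.inp p l s) W) (Stream'.Seq.cons (Act.inp p l s') W')
  | out {p : P} {l : L} {s s' : S} {W W' : SISO P L S} :
      le s s' → R W W' →
      Step le R (Stream'.Seq.cons (Act.out p l s) W) (Stream'.Seq.cons (Act.out p l s') W')
  | ctxA {p : P} {l : L} {s s' : S} {W W' : SISO P L S} {A : List (Act P L S)} :
      le s' s → ACtx p A → R W (prepend A W') → acts W = acts (prepend A W') →
      Step le R (Stream'.Seq.cons (Act.inp p l s) W)
        (prepend A (Stream'.Seq.cons (Act.inp p l s') W'))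
  | ctxB {p : P} {l : L} {s s' : S} {W W' : SISO P L S} {B : List (Act P L S)} :
      le s s' → BCtx p B → R W (prepend B W') → acts W = acts (prepend B W') →
      Step le R (Stream'.Seq.cons (Act.out p l s) W)
        (prepend B (Stream'.Seq.cons (Act.out p l s') W'))

/-- The tree refinement relation `≲`: the greatest relation closed under the rules,
i.e. the union of all post-fixpoints of `Step le`. -/
def Refines {P L S : Type} (le : S → S → Prop) (W W' : SISO P L S) : Prop :=
  ∃ R : SISO P L S → SISO P L S → Prop,
    (∀ a b, R a b → Step le R a b) ∧ R W W'

/-- The stream underlying the optimised ring-protocol branch `W_f`, whose `i`-th block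
is `c!ℓ_f(i)(v).a?add(v)`; it satisfies `W_f = c!ℓ_f(0)(v).a?add(v).W_{f ∘ succ}`. -/
def ringStream {P L S : Type} (a c : P) (add sub : L) (v : S) (f : ℕ → Bool) :
    Stream' (Act P L S) := fun n =>
  if n % 2 = 0 then Act.out c (if f (n / 2) then add else sub) v else Act.inp a add v

theorem acts_cons {P L S : Type} (t : Act P L S) (W : SISO P L S) :
    acts (Stream'.Seq.cons t W) = insert (actOf t) (acts W) := by
  ext x
  constructor
  · rintro ⟨n, u, hn, rfl⟩
    cases n with
    | zero =>
      rw [Stream'.Seq.get?_cons_zero, Option.some.injEq] at hn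
      exact Or.inl (congrArg actOf hn.symm)
    | succ n => exact Or.inr ⟨n, u, by rwa [Stream'.Seq.get?_cons_succ] at hn, rfl⟩
  · rintro (rfl | ⟨n, u, hn, rfl⟩)
    · exact ⟨0, t, Stream'.Seq.get?_cons_zero t W, rfl⟩
    · exact ⟨n + 1, u, by rwa [Stream'.Seq.get?_cons_succ], rfl⟩

/-- Unfolding of the first block of a ring-protocol branch. -/
theorem ofStream_ringStream {P L S : Type} (a c : P) (add sub : L) (v : S) (f : ℕ → Bool) :
    (Stream'.Seq.ofStream (ringStream a c add sub v f) : SISO P L S) =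
      Stream'.Seq.cons (Act.out c (if f 0 then add else sub) v)
        (Stream'.Seq.cons (Act.inp a add v)
          (Stream'.Seq.ofStream (ringStream a c add sub v (f ∘ Nat.succ)))) := by
  apply Stream'.Seq.ext
  rintro (_ | _ | n)
  · rfl
  · rfl
  · rw [Stream'.Seq.get?_cons_succ, Stream'.Seq.get?_cons_succ]
    change some (ringStream a c add sub v f (n + 2)) =
      some (ringStream a c add sub v (f ∘ Nat.succ) n)
    simp [ringStream]

theorem stmt10 {P L S : Type} (le : S → S → Prop) (hrefl : ∀ x : S, le x x)
    (a c : P) (hac : a ≠ c) (add sub : L) (v : S) :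
    ∀ f : ℕ → Bool,
      Refines le
        (Stream'.Seq.ofStream (ringStream a c add sub v f))
        (Stream'.Seq.cons (Act.inp a add v)
          (Stream'.Seq.ofStream (ringStream a c add sub v f))) := by
  intro f
  refine ⟨fun x y => y = Stream'.Seq.cons (Act.inp a add v) x ∧ ∃ g : ℕ → Bool,
    x = Stream'.Seq.ofStream (ringStream a c add sub v g) ∨
      x = Stream'.Seq.cons (Act.inp a add v)
        (Stream'.Seq.ofStream (ringStream a c add sub v g)), ?_, rfl, f, Or.inl rfl⟩
  rintro x y ⟨rfl, g, rfl | rfl⟩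
  · rw [ofStream_ringStream]
    refine Step.ctxB (B := [Act.inp a add v]) (hrefl v) ⟨by simp, by simp⟩
      ⟨rfl, g ∘ Nat.succ, Or.inr rfl⟩ ?_
    simp [prepend, acts_cons]
  · exact Step.inp (hrefl v) ⟨rfl, g, Or.inl rfl⟩
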